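/- arXiv:1711.10696 — 3 statements merged into one kernel-verified Lean document; each statement's English description precedes it below -/
import Mathlib

section
/- Let Y = (Y_1, ..., Y_p) be a centered Gaussian random vector in ℝ^p such that E[Y_j^2] ≥ σ̲^2 for all j = 1, ..., p, where σ̲ > 0 is a constant. Then for every y ∈ ℝ^p and every δ > 0, P(Y_j ≤ y_j + δ for all j) − P(Y_j ≤ y_j for all j) ≤ (δ/σ̲)(√(2 log p) + 2). -/
open MeasureTheory
open scoped RealInnerProductSpace

/-- The standard Gaussian measure `γ_p` on `ℝ^p`, given by its density
`φ_p(x) = (2π)^{−p/2} e^{−‖x‖²/2}` with respect to Lebesgue measure. -/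
noncomputable def stdGaussian (p : ℕ) : Measure (EuclideanSpace ℝ (Fin p)) :=
  volume.withDensity fun x =>
    ENNReal.ofReal ((2 * Real.pi) ^ (-(p : ℝ) / 2) * Real.exp (-‖x‖ ^ 2 / 2))

section

open ProbabilityTheory hiding stdGaussian
open scoped ENNReal

/-- On the event that `j` is the first index maximising `Z i - b i`, the law of `Z j` has density
`φ * G` with respect to Lebesgue measure, where `φ` is the standard Gaussian density and
`G` is nondecreasing. -/
theorem exists_monotone_density_argmax {Ω ι : Type*} [MeasurableSpace Ω] [Fintype ι] [LinearOrder ι]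
    {P : Measure Ω} {Z : ι → Ω → ℝ} (hZ : ∀ i, Measurable (Z i))
    (hG : HasGaussianLaw (fun ω i => Z i ω) P) (h0 : ∀ i, ∫ ω, Z i ω ∂P = 0)
    (h1 : ∀ i, variance (Z i) P = 1) (b : ι → ℝ) (j : ι) :
    ∃ G : ℝ → ℝ≥0∞, Monotone G ∧ (∀ z, G z ≤ 1) ∧ ∀ S, MeasurableSet S →
      P {ω | (∀ k, Z k ω - b k ≤ Z j ω - b j ∧ (k < j → Z k ω - b k < Z j ω - b j)) ∧ Z j ω ∈ S}
        = ∫⁻ z in S, gaussianPDF 0 1 z * G z := by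
  have hP : IsProbabilityMeasure P := hG.isProbabilityMeasure
  have hL2 : ∀ i, MemLp (Z i) 2 P := fun i => (hG.eval i).memLp_two
  set ρ : ι → ℝ := fun k => covariance (Z k) (Z j) P with hρ
  have hρ1 : ∀ k, ρ k ≤ 1 := by
    intro k
    have h := variance_nonneg (Z k - Z j) P
    rw [variance_sub (hL2 k) (hL2 j), h1, h1] at h
    simp only [hρ]; linarith
  let W : Ω → ι → ℝ := fun ω k => Z k ω - ρ k * Z j ω
  have hW : Measurable W := by fun_prop
  have hlaw : P.map (Z j) = gaussianReal 0 1 := by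
    rw [(hG.eval j).map_eq_gaussianReal, h0, h1]; simp
  have hindep : IndepFun (Z j) W P := by
    let L : (ι → ℝ) →L[ℝ] (Unit → ℝ) × (ι → ℝ) :=
      (ContinuousLinearMap.pi fun _ => ContinuousLinearMap.proj j).prod
        (ContinuousLinearMap.pi fun k => ContinuousLinearMap.proj k - ρ k • ContinuousLinearMap.proj j)
    have hL : HasGaussianLaw (fun ω => ((fun _ : Unit => Z j ω), fun k => Z k ω - ρ k * Z j ω)) P :=
      hG.map_fun L
    have h := HasGaussianLaw.indepFun_of_covariance_eval (X := fun _ : Unit => Z j)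
      (Y := fun k ω => Z k ω - ρ k * Z j ω) hL fun _ k => by
        rw [covariance_fun_sub_right (hL2 j) (hL2 k) ((hL2 j).const_mul _),
          covariance_const_mul_right, covariance_self (hZ j).aemeasurable, h1, covariance_comm]
        simp [hρ]
    exact h.comp (φ := fun x : Unit → ℝ => x ()) (ψ := id) (by fun_prop) measurable_id
  let C : Set (ℝ × (ι → ℝ)) := {q | ∀ k, q.2 k + ρ k * q.1 - b k ≤ q.1 - b j ∧
    (k < j → q.2 k + ρ k * q.1 - b k < q.1 - b j)}
  have hC : MeasurableSet C := by
    simp only [C, Set.ofPred_forall, Set.ofPred_and]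
    refine .iInter fun k => (measurableSet_le (by fun_prop) (by fun_prop)).inter ?_
    exact .iInter fun _ => measurableSet_lt (by fun_prop) (by fun_prop)
  have hWprob : IsProbabilityMeasure (P.map W) := Measure.isProbabilityMeasure_map hW.aemeasurable
  refine ⟨fun z => P.map W (Prod.mk z ⁻¹' C), ?_, fun z => prob_le_one, fun S hS => ?_⟩
  · intro z z' hz
    refine measure_mono fun w hw k => ?_
    have hm : 0 ≤ (1 - ρ k) * (z' - z) := mul_nonneg (by linarith [hρ1 k]) (by linarith)
    obtain ⟨h2, h3⟩ := hw k
    simp only at h2 h3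
    exact ⟨by nlinarith, fun hk => by have := h3 hk; nlinarith⟩
  · have hset : {ω | (∀ k, Z k ω - b k ≤ Z j ω - b j ∧ (k < j → Z k ω - b k < Z j ω - b j))
        ∧ Z j ω ∈ S} = (fun ω => (Z j ω, W ω)) ⁻¹' (C ∩ S ×ˢ Set.univ) := by
      ext ω; simp [C, W]
    have hCS : MeasurableSet (C ∩ S ×ˢ (Set.univ : Set (ι → ℝ))) := hC.inter (hS.prod .univ)
    rw [hset, ← Measure.map_apply ((hZ j).prodMk hW) hCS,
      (indepFun_iff_map_prod_eq_prod_map_map (hZ j).aemeasurable hW.aemeasurable).1 hindep,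
      hlaw, Measure.prod_apply hCS, gaussianReal_of_var_ne_zero 0 one_ne_zero,
      lintegral_withDensity_eq_lintegral_mul _ (measurable_gaussianPDF 0 1)
        (measurable_measure_prodMk_left hCS), ← lintegral_indicator hS]
    refine lintegral_congr fun z => ?_
    by_cases hz : z ∈ S
    · simp [hz, Set.indicator, Set.preimage_inter, Set.mk_preimage_prod_right]
    · simp [hz, Set.indicator, Set.preimage_inter]

/-- Lower bound for the Gaussian upper tail: `φ z ≤ (L + 1) * (1 - Φ z)` for `z ≤ L`, `0 ≤ L`. -/
theorem gaussianPDF_le_mul_lintegral_Ioi {z L : ℝ} (hL : 0 ≤ L) (hz : z ≤ L) :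
    gaussianPDF 0 1 z ≤ ENNReal.ofReal (L + 1) * ∫⁻ x in Set.Ioi z, gaussianPDF 0 1 x := by
  have hpdf : ∀ x, gaussianPDFReal 0 1 x = (√(2 * Real.pi))⁻¹ * Real.exp (-x ^ 2 / 2) := by
    intro x; simp [gaussianPDFReal]
  have hderiv : ∀ x, HasDerivAt (gaussianPDFReal 0 1) (-x * gaussianPDFReal 0 1 x) x := by
    intro x
    rw [funext hpdf]
    refine (((hasDerivAt_pow 2 x).fun_neg.div_const 2).exp.const_mul _).congr_deriv ?_
    simp only [Nat.cast_ofNat, Nat.add_one_sub_one, pow_one]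
    ring
  have hpos : ∀ x, 0 < gaussianPDFReal 0 1 x := fun x => gaussianPDFReal_pos _ _ _ one_ne_zero
  set c := max z 0 with hc
  have hc0 : 0 ≤ c := le_max_right _ _
  have hcL : c ≤ L := max_le hz hL
  have hle : gaussianPDFReal 0 1 z ≤ gaussianPDFReal 0 1 c := by
    rw [hpdf, hpdf]
    refine mul_le_mul_of_nonneg_left (Real.exp_le_exp.2 ?_) (by positivity)
    rcases le_total z 0 with h | h
    · rw [hc, max_eq_right h]; nlinarith [sq_nonneg z]
    · rw [hc, max_eq_left h]
  have hint : IntegrableOn (gaussianPDFReal 0 1) (Set.Ioi c) :=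
    (integrable_gaussianPDFReal 0 1).integrableOn
  have hkey : gaussianPDFReal 0 1 c / (c + 1) ≤ ∫ x in Set.Ioi c, gaussianPDFReal 0 1 x := by
    have hd : ∀ x ∈ Set.Ici c, HasDerivAt (fun x => -(gaussianPDFReal 0 1 x / (x + 1)))
        (gaussianPDFReal 0 1 x * ((x ^ 2 + x + 1) / (x + 1) ^ 2)) x := by
      intro x hx
      have hx1 : x + 1 ≠ 0 := by have : c ≤ x := hx; linarith
      refine ((hderiv x).fun_div ((hasDerivAt_id' x).add_const 1) hx1).fun_neg.congr_deriv ?_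
      field_simp; ring
    have hbd : ∀ x ∈ Set.Ioi c, (x ^ 2 + x + 1) / (x + 1) ^ 2 ≤ 1 := by
      intro x hx
      have : c < x := hx
      rw [div_le_one (by nlinarith)]; nlinarith
    have htend : Filter.Tendsto (fun x => -(gaussianPDFReal 0 1 x / (x + 1))) Filter.atTop
        (nhds 0) := by
      have h1 : Filter.Tendsto (fun x : ℝ => -((√(2 * Real.pi))⁻¹ / (x + 1))) Filter.atTop
          (nhds 0) := by
        rw [← neg_zero]
        exact (Filter.tendsto_atTop_add_const_right _ 1 Filter.tendsto_id).const_div_atTop _ |>.neg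
      refine tendsto_of_tendsto_of_tendsto_of_le_of_le' h1 tendsto_const_nhds ?_ ?_
      · filter_upwards [Filter.eventually_ge_atTop 0] with x hx
        have : gaussianPDFReal 0 1 x ≤ (√(2 * Real.pi))⁻¹ := by
          rw [hpdf]
          exact mul_le_of_le_one_right (by positivity) (Real.exp_le_one_iff.2 (by nlinarith))
        gcongr
      · filter_upwards [Filter.eventually_ge_atTop 0] with x hx
        have := hpos x
        simp only [Left.neg_nonpos_iff]; positivity
    have hnn : ∀ x ∈ Set.Ioi c, 0 ≤ gaussianPDFReal 0 1 x * ((x ^ 2 + x + 1) / (x + 1) ^ 2) := by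
      intro x hx
      have := hpos x
      have : c < x := hx
      have : 0 < x := by linarith
      positivity
    have h := integral_Ioi_of_hasDerivAt_of_nonneg' hd hnn htend
    calc gaussianPDFReal 0 1 c / (c + 1)
        = ∫ x in Set.Ioi c, gaussianPDFReal 0 1 x * ((x ^ 2 + x + 1) / (x + 1) ^ 2) := by
          rw [h]; ring
      _ ≤ _ := by
          refine setIntegral_mono_on (integrableOn_Ioi_deriv_of_nonneg' hd hnn htend) hint
            measurableSet_Ioi fun x hx => ?_
          exact mul_le_of_le_one_right (hpos x).le (hbd x hx)
  have htail : gaussianPDF 0 1 z ≤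
      ENNReal.ofReal (L + 1) * ∫⁻ x in Set.Ioi c, gaussianPDF 0 1 x := by
    simp only [gaussianPDF]
    rw [← ofReal_integral_eq_lintegral_ofReal hint (.of_forall fun x => (hpos x).le),
      ← ENNReal.ofReal_mul (by linarith)]
    refine ENNReal.ofReal_le_ofReal (hle.trans ?_)
    rw [div_le_iff₀ (by linarith)] at hkey
    have : 0 ≤ ∫ x in Set.Ioi c, gaussianPDFReal 0 1 x := integral_nonneg fun x => (hpos x).le
    nlinarith
  refine htail.trans ?_
  gcongr
  exact le_max_left _ _

/-- The standard Gaussian density is at most `1 / p` beyond `√(2 log p)`. -/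
theorem gaussianPDF_le_inv_of_sqrt_log_le {p : ℕ} (hp : 1 ≤ p) {z : ℝ}
    (hz : √(2 * Real.log p) ≤ z) : gaussianPDF 0 1 z ≤ (p : ℝ≥0∞)⁻¹ := by
  have hp0 : (0 : ℝ) < p := by exact_mod_cast hp
  have hlog : 2 * Real.log p ≤ z ^ 2 := by
    rwa [← Real.sqrt_le_left ((Real.sqrt_nonneg _).trans hz)]
  rw [gaussianPDF, ← ENNReal.ofReal_natCast, ← ENNReal.ofReal_inv_of_pos hp0]
  refine ENNReal.ofReal_le_ofReal ?_
  calc gaussianPDFReal 0 1 z = (√(2 * Real.pi))⁻¹ * Real.exp (-z ^ 2 / 2) := by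
        simp [gaussianPDFReal]
    _ ≤ 1 * Real.exp (-Real.log p) := by
        gcongr
        · exact inv_le_one_of_one_le₀ (Real.one_le_sqrt.2 (by linarith [Real.pi_gt_three]))
        · linarith
    _ = (p : ℝ)⁻¹ := by rw [one_mul, Real.exp_neg, Real.exp_log hp0]

/-- Anti-concentration of the maximum of standardised jointly Gaussian variables. -/
theorem measure_exists_gt_and_forall_le {Ω ι : Type*} [MeasurableSpace Ω] [Fintype ι]
    [Nonempty ι] [LinearOrder ι]
    {P : Measure Ω} {Z : ι → Ω → ℝ} (hZ : ∀ i, Measurable (Z i))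
    (hG : HasGaussianLaw (fun ω i => Z i ω) P) (h0 : ∀ i, ∫ ω, Z i ω ∂P = 0)
    (h1 : ∀ i, variance (Z i) P = 1) (b : ι → ℝ) (ε : ℝ) :
    P {ω | (∀ i, Z i ω ≤ b i + ε) ∧ ∃ i, b i < Z i ω} ≤
      ENNReal.ofReal (√(2 * Real.log (Fintype.card ι)) + 2) * ENNReal.ofReal ε := by
  have hP : IsProbabilityMeasure P := hG.isProbabilityMeasure
  choose G hmono hG1 hden using exists_monotone_density_argmax hZ hG h0 h1 b
  set L := √(2 * Real.log (Fintype.card ι)) with hL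
  have hL0 : 0 ≤ L := Real.sqrt_nonneg _
  set A : ι → Set ℝ → Set Ω := fun j S =>
    {ω | (∀ k, Z k ω - b k ≤ Z j ω - b j ∧ (k < j → Z k ω - b k < Z j ω - b j)) ∧ Z j ω ∈ S} with hA
  have hAmeas : ∀ j S, MeasurableSet S → MeasurableSet (A j S) := fun j S hS => by
    simp only [hA, Set.ofPred_forall, Set.ofPred_and]
    refine .inter (.iInter fun k =>
      (measurableSet_le (by fun_prop) (by fun_prop)).inter ?_) (hZ j hS)
    exact .iInter fun _ => measurableSet_lt (by fun_prop) (by fun_prop)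
  have hAdisj : ∀ S : ι → Set ℝ, Pairwise (Function.onFun Disjoint fun j => A j (S j)) := by
    intro S i j hij
    refine Set.disjoint_left.2 fun ω hi hj => ?_
    rcases lt_or_gt_of_ne hij with h | h
    · exact absurd ((hj.1 i).2 h) (not_lt.2 (hi.1 j).1)
    · exact absurd ((hi.1 j).2 h) (not_lt.2 (hj.1 i).1)
  have hcover : {ω | (∀ i, Z i ω ≤ b i + ε) ∧ ∃ i, b i < Z i ω} ⊆
      ⋃ j, A j (Set.Ioc (b j) (b j + ε)) := by
    rintro ω ⟨hle, i, hi⟩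
    obtain ⟨j₀, -, hj₀⟩ := Finset.exists_max_image Finset.univ (fun k => Z k ω - b k) ⟨i, by simp⟩
    let M : Finset ι := {k | Z k ω - b k = Z j₀ ω - b j₀}
    have hM : M.Nonempty := ⟨j₀, by simp [M]⟩
    have hj : Z (M.min' hM) ω - b (M.min' hM) = Z j₀ ω - b j₀ := by simpa [M] using M.min'_mem hM
    refine Set.mem_iUnion.2 ⟨M.min' hM, fun k => ⟨hj ▸ hj₀ k (by simp), fun hk => ?_⟩, ?_, hle _⟩
    · refine lt_of_le_of_ne (hj ▸ hj₀ k (by simp)) fun h => ?_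
      exact absurd (M.min'_le k (by simp [M, h, hj])) (not_le.2 hk)
    · have := hj₀ i (by simp)
      linarith
  have hpt : ∀ j z, gaussianPDF 0 1 z * G j z ≤
      ENNReal.ofReal (L + 1) * P (A j (Set.Ioi z)) + (Fintype.card ι : ℝ≥0∞)⁻¹ := by
    intro j z
    rcases le_total z L with h | h
    · refine le_add_right ?_
      calc gaussianPDF 0 1 z * G j z
          ≤ (ENNReal.ofReal (L + 1) * ∫⁻ x in Set.Ioi z, gaussianPDF 0 1 x) * G j z := by
            gcongr; exact gaussianPDF_le_mul_lintegral_Ioi hL0 h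
        _ = ENNReal.ofReal (L + 1) * ∫⁻ x in Set.Ioi z, gaussianPDF 0 1 x * G j z := by
            rw [lintegral_mul_const _ (measurable_gaussianPDF 0 1), mul_assoc]
        _ ≤ ENNReal.ofReal (L + 1) * ∫⁻ x in Set.Ioi z, gaussianPDF 0 1 x * G j x := by
            refine mul_le_mul' le_rfl (setLIntegral_mono' measurableSet_Ioi fun x hx => ?_)
            gcongr
            exact hmono j (le_of_lt hx)
        _ = _ := by rw [hden j _ measurableSet_Ioi]
    · refine le_add_left ?_
      calc gaussianPDF 0 1 z * G j z ≤ gaussianPDF 0 1 z * 1 := by gcongr; exact hG1 j z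
        _ ≤ _ := by
          rw [mul_one]; exact gaussianPDF_le_inv_of_sqrt_log_le Fintype.card_pos h
  have hshift : ∀ j, P (A j (Set.Ioc (b j) (b j + ε))) =
      ∫⁻ t in Set.Ioc 0 ε, gaussianPDF 0 1 (b j + t) * G j (b j + t) := by
    intro j
    rw [hden j _ measurableSet_Ioc, ← lintegral_indicator measurableSet_Ioc,
      ← lintegral_indicator measurableSet_Ioc, ← lintegral_add_left_eq_self _ (b j)]
    refine lintegral_congr fun t => ?_
    by_cases ht : t ∈ Set.Ioc 0 ε
    · rw [Set.indicator_of_mem ht, Set.indicator_of_mem (by simpa using ht)]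
    · rw [Set.indicator_of_notMem ht, Set.indicator_of_notMem (by simpa using ht)]
  have hsum : ∀ t, ∑ j, gaussianPDF 0 1 (b j + t) * G j (b j + t) ≤ ENNReal.ofReal (L + 2) := by
    intro t
    have hone : ∑ j, P (A j (Set.Ioi (b j + t))) ≤ 1 := by
      rw [← tsum_fintype (L := .unconditional _),
        ← measure_iUnion (hAdisj _) fun j => hAmeas _ _ measurableSet_Ioi]
      exact prob_le_one
    calc ∑ j, gaussianPDF 0 1 (b j + t) * G j (b j + t)
        ≤ ∑ j, (ENNReal.ofReal (L + 1) * P (A j (Set.Ioi (b j + t)))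
            + (Fintype.card ι : ℝ≥0∞)⁻¹) := Finset.sum_le_sum fun j _ => hpt j _
      _ = ENNReal.ofReal (L + 1) * ∑ j, P (A j (Set.Ioi (b j + t))) + 1 := by
          rw [Finset.sum_add_distrib, ← Finset.mul_sum, Finset.sum_const, nsmul_eq_mul,
            Finset.card_univ, ENNReal.mul_inv_cancel (by simp) (by simp)]
      _ ≤ ENNReal.ofReal (L + 1) * 1 + 1 := by gcongr
      _ = ENNReal.ofReal (L + 2) := by
          rw [mul_one, ← ENNReal.ofReal_one, ← ENNReal.ofReal_add (by linarith) zero_le_one]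
          ring_nf
  calc P {ω | (∀ i, Z i ω ≤ b i + ε) ∧ ∃ i, b i < Z i ω}
      ≤ P (⋃ j, A j (Set.Ioc (b j) (b j + ε))) := measure_mono hcover
    _ ≤ ∑ j, P (A j (Set.Ioc (b j) (b j + ε))) := measure_iUnion_fintype_le _ _
    _ = ∫⁻ t in Set.Ioc 0 ε, ∑ j, gaussianPDF 0 1 (b j + t) * G j (b j + t) := by
        rw [lintegral_finsetSum]
        · simp_rw [hshift]
        · intro j _
          exact ((measurable_gaussianPDF 0 1).comp (measurable_const_add _)).mul
            ((hmono j).measurable.comp (measurable_const_add _))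
    _ ≤ ∫⁻ _ in Set.Ioc 0 ε, ENNReal.ofReal (L + 2) := lintegral_mono hsum
    _ = ENNReal.ofReal (L + 2) * ENNReal.ofReal ε := by simp

/-- The standard Gaussian measure given by its density agrees with the one of the library. -/
theorem stdGaussian_eq_probabilityTheory_stdGaussian {p : ℕ}
    (h : IsFiniteMeasure (_root_.stdGaussian p)) :
    _root_.stdGaussian p = ProbabilityTheory.stdGaussian (EuclideanSpace ℝ (Fin p)) := by
  refine Measure.ext_of_charFun (funext fun t => ?_)
  rw [charFun_stdGaussian, charFun_apply, _root_.stdGaussian,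
    integral_withDensity_eq_integral_toReal_smul (by fun_prop) (by simp)]
  have hpi : (0 : ℝ) < 2 * Real.pi := by positivity
  have hint : ∀ x : EuclideanSpace ℝ (Fin p),
      (ENNReal.ofReal ((2 * Real.pi) ^ (-(p : ℝ) / 2) * Real.exp (-‖x‖ ^ 2 / 2))).toReal •
        Complex.exp (⟪x, t⟫ * Complex.I) =
      (((2 * Real.pi) ^ (-(p : ℝ) / 2) : ℝ) : ℂ) *
        Complex.exp (-(1 / 2 : ℂ) * ‖x‖ ^ 2 + Complex.I * ⟪t, x⟫) := by
    intro x
    rw [ENNReal.toReal_ofReal (by positivity), Complex.real_smul, Complex.ofReal_mul,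
      Complex.ofReal_exp, mul_assoc, ← Complex.exp_add, real_inner_comm]
    congr 2
    push_cast
    ring
  simp_rw [hint]
  rw [integral_const_mul, GaussianFourier.integral_cexp_neg_mul_sq_norm_add (by norm_num),
    ← mul_assoc, finrank_euclideanSpace_fin]
  have hc : (((2 * Real.pi) ^ (-(p : ℝ) / 2) : ℝ) : ℂ) * (Real.pi / (1 / 2 : ℂ)) ^ ((p : ℂ) / 2)
      = 1 := by
    have : (Real.pi / (1 / 2 : ℂ)) ^ ((p : ℂ) / 2) = (((2 * Real.pi) ^ ((p : ℝ) / 2) : ℝ) : ℂ) := by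
      rw [Complex.ofReal_cpow hpi.le]
      push_cast
      congr 1
      ring
    rw [this, ← Complex.ofReal_mul, ← Real.rpow_add hpi]
    simp [neg_div]
  rw [hc, one_mul]
  congr 1
  rw [Complex.I_sq]
  ring

end

/-- **Nazarov's inequality.** Let `Y` be a centered Gaussian random vector in
`ℝ^p` (i.e. `Y` has the law of `A X` for some matrix `A`, where `X ∼ N(0, I_p)`) with
`E[Y_j²] ≥ σ̲² > 0` for all `j`. Then for every `y ∈ ℝ^p` and `δ > 0`,
`P(Y ≤ y + δ) − P(Y ≤ y) ≤ (δ/σ̲)(√(2 log p) + 2)`. -/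
theorem nazarov_inequality {Ω : Type*} [MeasurableSpace Ω]
    (P : Measure Ω) [IsProbabilityMeasure P] {p : ℕ} (hp : 1 ≤ p)
    (Y : Ω → EuclideanSpace ℝ (Fin p)) (hYmeas : Measurable Y)
    (hYgauss : ∃ A : Matrix (Fin p) (Fin p) ℝ,
      Measure.map Y P = Measure.map (Matrix.toEuclideanLin A) (stdGaussian p))
    (σ₀ : ℝ) (hσ₀ : 0 < σ₀) (hvar : ∀ j, σ₀ ^ 2 ≤ ∫ ω, (Y ω j) ^ 2 ∂P)
    (y : EuclideanSpace ℝ (Fin p)) (δ : ℝ) (hδ : 0 < δ) :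
    (P {ω | ∀ j, Y ω j ≤ y j + δ}).toReal - (P {ω | ∀ j, Y ω j ≤ y j}).toReal
      ≤ δ / σ₀ * (Real.sqrt (2 * Real.log p) + 2) := by
  obtain ⟨A, hA⟩ := hYgauss
  let T : EuclideanSpace ℝ (Fin p) →L[ℝ] EuclideanSpace ℝ (Fin p) :=
    LinearMap.toContinuousLinearMap (Matrix.toEuclideanLin A)
  have hT : Measurable (Matrix.toEuclideanLin A) := T.continuous.measurable
  have hfin : IsFiniteMeasure (stdGaussian p) := by
    refine ⟨?_⟩
    have h := congrArg (fun μ => μ Set.univ) hA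
    simp only [Measure.map_apply hYmeas .univ, Measure.map_apply hT .univ, Set.preimage_univ] at h
    rw [← h]
    exact measure_lt_top _ _
  rw [stdGaussian_eq_probabilityTheory_stdGaussian hfin] at hA
  have hYG : ProbabilityTheory.HasGaussianLaw Y P := by
    refine ⟨?_⟩
    rw [hA]
    exact ProbabilityTheory.isGaussian_map T
  have hYj : ∀ j, Measurable fun ω => Y ω j := fun j => by fun_prop
  have hmean : ∀ j, ∫ ω, Y ω j ∂P = 0 := by
    intro j
    rw [← integral_map (f := fun x : EuclideanSpace ℝ (Fin p) => x j) hYmeas.aemeasurable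
      (by fun_prop), hA, integral_map hT.aemeasurable (by fun_prop)]
    exact ProbabilityTheory.integral_strongDual_stdGaussian
      ((EuclideanSpace.proj j : _ →L[ℝ] ℝ).comp T)
  have hvarY : ∀ j, ProbabilityTheory.variance (fun ω => Y ω j) P = ∫ ω, (Y ω j) ^ 2 ∂P := fun j =>
    ProbabilityTheory.variance_of_integral_eq_zero (hYj j).aemeasurable (hmean j)
  set s : Fin p → ℝ := fun j => √(∫ ω, (Y ω j) ^ 2 ∂P) with hs
  have hσs : ∀ j, σ₀ ≤ s j := fun j => Real.le_sqrt_of_sq_le (hvar j)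
  have hspos : ∀ j, 0 < s j := fun j => hσ₀.trans_le (hσs j)
  let Z : Fin p → Ω → ℝ := fun j ω => (s j)⁻¹ * Y ω j
  have hZG : ProbabilityTheory.HasGaussianLaw (fun ω j => Z j ω) P := by
    let D : EuclideanSpace ℝ (Fin p) →L[ℝ] (Fin p → ℝ) :=
      ContinuousLinearMap.pi fun j => (s j)⁻¹ • (EuclideanSpace.proj j : _ →L[ℝ] ℝ)
    exact hYG.map_fun D
  have : Nonempty (Fin p) := ⟨⟨0, hp⟩⟩
  have hmain := measure_exists_gt_and_forall_le (P := P) (Z := Z)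
    (fun j => (hYj j).const_mul _) hZG
    (fun j => by simp only [Z]; rw [integral_const_mul, hmean, mul_zero])
    (fun j => by
      simp only [Z]
      rw [ProbabilityTheory.variance_const_mul, hvarY, inv_pow, hs,
        Real.sq_sqrt ((sq_nonneg σ₀).trans (hvar j)), inv_mul_cancel₀]
      exact ((pow_pos hσ₀ 2).trans_le (hvar j)).ne')
    (fun j => (s j)⁻¹ * y j) (δ / σ₀)
  rw [Fintype.card_fin, ← ENNReal.ofReal_mul (by positivity)] at hmain
  have hsub : {ω | ∀ j, Y ω j ≤ y j + δ} ⊆ {ω | ∀ j, Y ω j ≤ y j} ∪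
      {ω | (∀ j, Z j ω ≤ (s j)⁻¹ * y j + δ / σ₀) ∧ ∃ j, (s j)⁻¹ * y j < Z j ω} := by
    intro ω hω
    by_cases h : ∀ j, Y ω j ≤ y j
    · exact Or.inl h
    · push Not at h
      obtain ⟨j, hj⟩ := h
      refine Or.inr ⟨fun k => ?_, j, mul_lt_mul_of_pos_left hj (inv_pos.2 (hspos j))⟩
      calc (s k)⁻¹ * Y ω k ≤ (s k)⁻¹ * (y k + δ) :=
            mul_le_mul_of_nonneg_left (hω k) (inv_pos.2 (hspos k)).le
        _ = (s k)⁻¹ * y k + δ / s k := by ring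
        _ ≤ _ := by gcongr; exact hσs k
  have hfinal := (measure_mono hsub).trans ((measure_union_le _ _).trans (add_le_add_right hmain _))
  have hreal := ENNReal.toReal_mono (by finiteness) hfinal
  rw [ENNReal.toReal_add (by finiteness) (by finiteness),
    ENNReal.toReal_ofReal (by positivity)] at hreal
  linarith
end

section
/- Let X be a standard Gaussian random vector in ℝ^p (i.e., X ∼ N(0, I_p)), let a_1, ..., a_p be unit vectors in ℝ^p, and let b_1, ..., b_p ∈ ℝ. Then for every δ > 0, P(⟨a_j, X⟩ ≤ b_j + δ for all j = 1, ..., p) − P(⟨a_j, X⟩ ≤ b_j for all j = 1, ..., p) ≤ δ(√(2 log p) + 2). -/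
open MeasureTheory
open scoped RealInnerProductSpace

open ProbabilityTheory in
theorem gaussianPDFReal_std_eq (t : ℝ) :
    gaussianPDFReal 0 1 t = (√(2 * Real.pi))⁻¹ * Real.exp (-t ^ 2 / 2) := by
  simp [gaussianPDFReal_def]

open ProbabilityTheory in
/-- The identity `φ' = -s φ` integrated from `t` to `L`. -/
theorem gaussianPDFReal_le_mul_tail_add {L : ℝ} (hL : 0 ≤ L) (t : ℝ) :
    gaussianPDFReal 0 1 t
      ≤ L * (gaussianReal 0 1).real (Set.Ici t) + gaussianPDFReal 0 1 L := by
  rcases le_total t L with htL | hLt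
  · have hderiv (s : ℝ) :
        HasDerivAt (fun s => -gaussianPDFReal 0 1 s) (s * gaussianPDFReal 0 1 s) s := by
      simp only [gaussianPDFReal_std_eq]
      have h : HasDerivAt (fun s : ℝ => -s ^ 2 / 2) (-s) s := by
        have := ((hasDerivAt_pow 2 s).neg).div_const 2
        exact this.congr_deriv (by norm_num; ring)
      convert! (h.exp.const_mul (√(2 * Real.pi))⁻¹).neg using 1
      ring
    have hcont : Continuous (gaussianPDFReal 0 1) := by
      simp_rw [funext gaussianPDFReal_std_eq]
      fun_prop
    have hftc : ∫ s in t..L, s * gaussianPDFReal 0 1 s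
        = gaussianPDFReal 0 1 t - gaussianPDFReal 0 1 L := by
      rw [intervalIntegral.integral_eq_sub_of_hasDerivAt (fun s _ => hderiv s)
        ((continuous_id.mul hcont).intervalIntegrable _ _)]
      ring
    have hle : ∫ s in t..L, s * gaussianPDFReal 0 1 s
        ≤ ∫ s in t..L, L * gaussianPDFReal 0 1 s :=
      intervalIntegral.integral_mono_on htL
        ((continuous_id.mul hcont).intervalIntegrable _ _)
        ((continuous_const.mul hcont).intervalIntegrable _ _)
        fun s hs => mul_le_mul_of_nonneg_right hs.2 (gaussianPDFReal_nonneg _ _ _)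
    have htail : ∫ s in t..L, gaussianPDFReal 0 1 s ≤ (gaussianReal 0 1).real (Set.Ici t) := by
      rw [measureReal_def, gaussianReal_apply_eq_integral _ one_ne_zero, ENNReal.toReal_ofReal
        (integral_nonneg fun s => gaussianPDFReal_nonneg _ _ _),
        intervalIntegral.integral_of_le htL]
      exact setIntegral_mono_set (integrable_gaussianPDFReal _ _).integrableOn
        (ae_of_all _ fun s => gaussianPDFReal_nonneg _ _ _)
        (Filter.Eventually.of_forall fun s hs => hs.1.le)
    rw [intervalIntegral.integral_const_mul] at hle
    have := mul_le_mul_of_nonneg_left htail hL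
    linarith
  · have : gaussianPDFReal 0 1 t ≤ gaussianPDFReal 0 1 L := by
      simp only [gaussianPDFReal_std_eq]
      gcongr
    have : 0 ≤ L * (gaussianReal 0 1).real (Set.Ici t) := by positivity
    linarith

open ProbabilityTheory in
theorem gaussianReal_upperSet_inter_Ioc_le {L : ℝ} (hL : 0 ≤ L) {U : Set ℝ} (hU : IsUpperSet U)
    (b δ : ℝ) :
    gaussianReal 0 1 (U ∩ Set.Ioc b (b + δ))
      ≤ ENNReal.ofReal δ
        * (ENNReal.ofReal L * gaussianReal 0 1 U + ENNReal.ofReal (gaussianPDFReal 0 1 L)) := by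
  have hpdf : ∀ t ∈ U, gaussianPDF 0 1 t
      ≤ ENNReal.ofReal L * gaussianReal 0 1 U + ENNReal.ofReal (gaussianPDFReal 0 1 L) := by
    intro t ht
    have hsub : Set.Ici t ⊆ U := fun s hs => hU hs ht
    calc gaussianPDF 0 1 t
        ≤ ENNReal.ofReal (L * (gaussianReal 0 1).real (Set.Ici t) + gaussianPDFReal 0 1 L) :=
          ENNReal.ofReal_le_ofReal (gaussianPDFReal_le_mul_tail_add hL t)
      _ = ENNReal.ofReal L * gaussianReal 0 1 (Set.Ici t)
            + ENNReal.ofReal (gaussianPDFReal 0 1 L) := by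
          rw [ENNReal.ofReal_add (by positivity) (gaussianPDFReal_nonneg _ _ _),
            ENNReal.ofReal_mul hL, ofReal_measureReal]
      _ ≤ _ := by gcongr
  have hUm : MeasurableSet U := hU.ordConnected.measurableSet
  rw [gaussianReal_apply _ one_ne_zero]
  calc ∫⁻ t in U ∩ Set.Ioc b (b + δ), gaussianPDF 0 1 t
      ≤ ∫⁻ _ in U ∩ Set.Ioc b (b + δ), (ENNReal.ofReal L * gaussianReal 0 1 U
          + ENNReal.ofReal (gaussianPDFReal 0 1 L)) :=
        setLIntegral_mono' (hUm.inter measurableSet_Ioc) fun t ht => hpdf t ht.1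
    _ ≤ _ := by
        rw [setLIntegral_const, mul_comm]
        gcongr
        exact (measure_mono Set.inter_subset_right).trans_eq (by simp)

theorem charFun_stdGaussian {p : ℕ} (t : EuclideanSpace ℝ (Fin p)) :
    charFun (stdGaussian p) t = Complex.exp (-(‖t‖ : ℂ) ^ 2 / 2) := by
  have hpi : (0 : ℝ) < 2 * Real.pi := by positivity
  rw [charFun_apply, stdGaussian, integral_withDensity_eq_integral_toReal_smul (by fun_prop)
    (ae_of_all _ fun _ => ENNReal.ofReal_lt_top)]
  have hint := GaussianFourier.integral_cexp_neg_mul_sq_norm_add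
    (b := 1 / 2) (by norm_num) Complex.I t
  have hconst : (((2 * Real.pi) ^ (-(p : ℝ) / 2) : ℝ) : ℂ)
      * ((Real.pi : ℂ) / (1 / 2)) ^ ((p : ℂ) / 2) = 1 := by
    have h2 : ((Real.pi : ℂ) / (1 / 2)) = ((2 * Real.pi : ℝ) : ℂ) := by push_cast; ring
    have h3 : ((p : ℂ) / 2) = (((p : ℝ) / 2 : ℝ) : ℂ) := by push_cast; ring
    rw [h2, h3, ← Complex.ofReal_cpow hpi.le, ← Complex.ofReal_mul, ← Real.rpow_add hpi]
    simp [neg_div]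
  have hfun (x : EuclideanSpace ℝ (Fin p)) :
      (ENNReal.ofReal ((2 * Real.pi) ^ (-(p : ℝ) / 2) * Real.exp (-‖x‖ ^ 2 / 2))).toReal
        • Complex.exp (⟪x, t⟫ * Complex.I)
      = (((2 * Real.pi) ^ (-(p : ℝ) / 2) : ℝ) : ℂ)
        * Complex.exp (-(1 / 2) * (‖x‖ : ℂ) ^ 2 + Complex.I * ⟪t, x⟫) := by
    rw [ENNReal.toReal_ofReal (by positivity), Complex.exp_add, Complex.real_smul,
      Complex.ofReal_mul, Complex.ofReal_exp, real_inner_comm]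
    push_cast
    ring_nf
  simp_rw [hfun]
  rw [integral_const_mul, hint, finrank_euclideanSpace_fin, ← mul_assoc, hconst, one_mul]
  congr 1
  simp
  ring

instance isFiniteMeasure_stdGaussian (p : ℕ) : IsFiniteMeasure (stdGaussian p) := by
  refine isFiniteMeasure_withDensity_ofReal (Integrable.hasFiniteIntegral ?_)
  have h := (GaussianFourier.integrable_cexp_neg_mul_sq_norm_add (b := 1 / 2) (by norm_num) 0
    (0 : EuclideanSpace ℝ (Fin p))).re
  refine (h.const_mul ((2 * Real.pi) ^ (-(p : ℝ) / 2))).congr (ae_of_all _ fun x => ?_)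
  have : (-(1 / 2) * (‖x‖ : ℂ) ^ 2 + 0 * (⟪(0 : EuclideanSpace ℝ (Fin p)), x⟫ : ℝ))
      = ((-‖x‖ ^ 2 / 2 : ℝ) : ℂ) := by push_cast; ring
  simp only [this, ← Complex.ofReal_exp, RCLike.re_to_complex, Complex.ofReal_re]

instance isProbabilityMeasure_stdGaussian (p : ℕ) : IsProbabilityMeasure (stdGaussian p) := by
  have h := charFun_stdGaussian (0 : EuclideanSpace ℝ (Fin p))
  rw [charFun_zero] at h
  rw [isProbabilityMeasure_iff_real]
  simpa using h

/-- Replacing the component of `x` along `a` by `z`. -/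
noncomputable def resample {p : ℕ} (a : EuclideanSpace ℝ (Fin p))
    (q : EuclideanSpace ℝ (Fin p) × ℝ) : EuclideanSpace ℝ (Fin p) :=
  q.1 + (q.2 - ⟪a, q.1⟫) • a

theorem measurable_resample {p : ℕ} (a : EuclideanSpace ℝ (Fin p)) : Measurable (resample a) := by
  unfold resample
  fun_prop

theorem inner_resample {p : ℕ} (a u x : EuclideanSpace ℝ (Fin p)) (z : ℝ) :
    ⟪u, resample a (x, z)⟫ = ⟪u, x⟫ + (z - ⟪a, x⟫) * ⟪u, a⟫ := by
  simp [resample, inner_add_right, inner_smul_right]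

theorem inner_resample_self {p : ℕ} {a : EuclideanSpace ℝ (Fin p)} (ha : ‖a‖ = 1)
    (x : EuclideanSpace ℝ (Fin p)) (z : ℝ) : ⟪a, resample a (x, z)⟫ = z := by
  simp [inner_resample, ha]

open ProbabilityTheory in
theorem map_resample_stdGaussian {p : ℕ} {a : EuclideanSpace ℝ (Fin p)} (ha : ‖a‖ = 1) :
    ((stdGaussian p).prod (gaussianReal 0 1)).map (resample a) = stdGaussian p := by
  have := Measure.isFiniteMeasure_map ((stdGaussian p).prod (gaussianReal 0 1)) (resample a)
  refine Measure.ext_of_charFun (funext fun t => ?_)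
  rw [charFun_apply, integral_map (measurable_resample a).aemeasurable
    (Continuous.aestronglyMeasurable (by fun_prop))]
  have hsplit (q : EuclideanSpace ℝ (Fin p) × ℝ) :
      Complex.exp (⟪resample a q, t⟫ * Complex.I)
        = Complex.exp (⟪q.1, t - ⟪a, t⟫ • a⟫ * Complex.I)
          * Complex.exp (⟪a, t⟫ * q.2 * Complex.I) := by
    rw [← Complex.exp_add, real_inner_comm, inner_resample, inner_sub_right, inner_smul_right,
      real_inner_comm t q.1, real_inner_comm a t, real_inner_comm a q.1]
    push_cast
    ring_nf
  simp_rw [hsplit]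
  rw [integral_prod_mul (fun x => Complex.exp (⟪x, t - ⟪a, t⟫ • a⟫ * Complex.I))
    (fun z : ℝ => Complex.exp (⟪a, t⟫ * z * Complex.I)), ← charFun_apply, ← charFun_apply_real,
    charFun_stdGaussian, charFun_stdGaussian, charFun_gaussianReal, ← Complex.exp_add]
  have hnorm : ‖t - ⟪a, t⟫ • a‖ ^ 2 = ‖t‖ ^ 2 - ⟪a, t⟫ ^ 2 := by
    rw [norm_sub_sq_real, inner_smul_right, norm_smul, ha, real_inner_comm a t, mul_one,
      Real.norm_eq_abs, sq_abs]
    ring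
  congr 1
  rw [← Complex.ofReal_pow, hnorm]
  push_cast
  ring

open ProbabilityTheory in
/-- If `E` is stable under moving in the direction of the unit vector `a`, then a slab of width
`δ` orthogonal to `a` meets `E` in Gaussian measure `O(δ)`. -/
theorem stdGaussian_inter_slab_le {p : ℕ} {a : EuclideanSpace ℝ (Fin p)} (ha : ‖a‖ = 1)
    {E : Set (EuclideanSpace ℝ (Fin p))} (hE : MeasurableSet E)
    (hup : ∀ x ∈ E, ∀ s : ℝ, 0 ≤ s → x + s • a ∈ E) {L : ℝ} (hL : 0 ≤ L) (b δ : ℝ) :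
    stdGaussian p (E ∩ {x | ⟪a, x⟫ ∈ Set.Ioc b (b + δ)})
      ≤ ENNReal.ofReal δ * (ENNReal.ofReal L * stdGaussian p E
        + ENNReal.ofReal (gaussianPDFReal 0 1 L)) := by
  have hprod {S : Set (EuclideanSpace ℝ (Fin p))} (hS : MeasurableSet S) :
      stdGaussian p S = ∫⁻ x, gaussianReal 0 1 {z | resample a (x, z) ∈ S} ∂stdGaussian p := by
    conv_lhs => rw [← map_resample_stdGaussian ha]
    rw [Measure.map_apply (measurable_resample a) hS,
      Measure.prod_apply (measurable_resample a hS)]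
    rfl
  have hmeas : Measurable fun x => gaussianReal 0 1 {z | resample a (x, z) ∈ E} :=
    measurable_measure_prodMk_left (measurable_resample a hE)
  have hslab : MeasurableSet {x : EuclideanSpace ℝ (Fin p) | ⟪a, x⟫ ∈ Set.Ioc b (b + δ)} :=
    measurableSet_Ioc.preimage (f := fun x => ⟪a, x⟫) (by fun_prop)
  rw [hprod (hE.inter hslab)]
  calc _ ≤ ∫⁻ x, ENNReal.ofReal δ * (ENNReal.ofReal L
            * gaussianReal 0 1 {z | resample a (x, z) ∈ E}
          + ENNReal.ofReal (gaussianPDFReal 0 1 L)) ∂stdGaussian p := by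
        refine lintegral_mono fun x => ?_
        have hU : IsUpperSet {z | resample a (x, z) ∈ E} := by
          intro z w hzw hz
          have := hup _ hz (w - z) (sub_nonneg.2 hzw)
          have heq : resample a (x, w) = resample a (x, z) + (w - z) • a := by
            simp only [resample]
            module
          rwa [Set.mem_ofPred_eq, heq]
        convert! gaussianReal_upperSet_inter_Ioc_le hL hU b δ using 2
        ext z
        simp [inner_resample_self ha]
    _ = _ := by
        rw [lintegral_const_mul _ (by fun_prop), lintegral_add_right _ measurable_const,
          lintegral_const_mul _ hmeas, ← hprod hE]
        simp

/-- The points at which `⟪a j, x⟫ - b j` is maximal and `j` is the first index attaining the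
maximum. -/
def firstArgmax {p : ℕ} (a : Fin p → EuclideanSpace ℝ (Fin p)) (b : Fin p → ℝ) (j : Fin p) :
    Set (EuclideanSpace ℝ (Fin p)) :=
  {x | ∀ k, ⟪a k, x⟫ - b k ≤ ⟪a j, x⟫ - b j ∧ (k < j → ⟪a k, x⟫ - b k < ⟪a j, x⟫ - b j)}

section firstArgmax

variable {p : ℕ} {a : Fin p → EuclideanSpace ℝ (Fin p)} {b : Fin p → ℝ}

theorem measurableSet_firstArgmax (j : Fin p) : MeasurableSet (firstArgmax a b j) := by
  simp only [firstArgmax, Set.ofPred_forall, Set.ofPred_and]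
  refine MeasurableSet.iInter fun k => (measurableSet_le (by fun_prop) (by fun_prop)).inter
    (MeasurableSet.iInter fun _ => measurableSet_lt (by fun_prop) (by fun_prop))

theorem pairwise_disjoint_firstArgmax :
    Pairwise (Function.onFun Disjoint (firstArgmax a b)) := by
  intro i j hij
  refine Set.disjoint_left.2 fun x hi hj => ?_
  rcases lt_or_gt_of_ne hij with h | h
  · exact ((hi j).1.trans_lt ((hj i).2 h)).false
  · exact ((hj i).1.trans_lt ((hi j).2 h)).false

theorem exists_mem_firstArgmax (hp : 1 ≤ p) (x : EuclideanSpace ℝ (Fin p)) :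
    ∃ j, x ∈ firstArgmax a b j := by
  have : Nonempty (Fin p) := ⟨⟨0, hp⟩⟩
  obtain ⟨m, hm⟩ := Finite.exists_max fun k => ⟪a k, x⟫ - b k
  obtain ⟨j, hj, hmin⟩ := WellFounded.has_min (wellFounded_lt (α := Fin p))
    {j | ∀ k, ⟪a k, x⟫ - b k ≤ ⟪a j, x⟫ - b j} ⟨m, hm⟩
  refine ⟨j, fun k => ⟨hj k, fun hk => lt_of_not_ge fun hle => hmin k ?_ hk⟩⟩
  exact fun i => (hj i).trans hle

theorem add_smul_mem_firstArgmax (ha : ∀ j, ‖a j‖ = 1) (j : Fin p)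
    {x : EuclideanSpace ℝ (Fin p)} (hx : x ∈ firstArgmax a b j) {s : ℝ} (hs : 0 ≤ s) :
    x + s • a j ∈ firstArgmax a b j := by
  intro k
  have hkj : s * ⟪a k, a j⟫ ≤ s * 1 :=
    mul_le_mul_of_nonneg_left ((real_inner_le_norm _ _).trans_eq (by simp [ha])) hs
  simp only [inner_add_right, inner_smul_right, real_inner_self_eq_norm_sq, ha]
  obtain ⟨h1, h2⟩ := hx k
  exact ⟨by linarith, fun hk => by linarith [h2 hk]⟩

end firstArgmax

open ProbabilityTheory in
theorem stdGaussian_diff_le {p : ℕ} (hp : 1 ≤ p) {a : Fin p → EuclideanSpace ℝ (Fin p)}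
    (ha : ∀ j, ‖a j‖ = 1) (b : Fin p → ℝ) (δ : ℝ) {L : ℝ} (hL : 0 ≤ L) :
    stdGaussian p ({x | ∀ j, ⟪a j, x⟫ ≤ b j + δ} \ {x | ∀ j, ⟪a j, x⟫ ≤ b j})
      ≤ ENNReal.ofReal δ
        * (ENNReal.ofReal L + p * ENNReal.ofReal (gaussianPDFReal 0 1 L)) := by
  have hsub : {x | ∀ j, ⟪a j, x⟫ ≤ b j + δ} \ {x | ∀ j, ⟪a j, x⟫ ≤ b j}
      ⊆ ⋃ j, firstArgmax a b j ∩ {x | ⟪a j, x⟫ ∈ Set.Ioc (b j) (b j + δ)} := by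
    rintro x ⟨hx, hx'⟩
    simp only [Set.mem_ofPred_eq, not_forall, not_le] at hx'
    obtain ⟨k, hk⟩ := hx'
    obtain ⟨j, hj⟩ := exists_mem_firstArgmax (a := a) (b := b) hp x
    exact Set.mem_iUnion.2 ⟨j, hj, by linarith [(hj k).1], hx j⟩
  calc _ ≤ ∑ j, stdGaussian p
          (firstArgmax a b j ∩ {x | ⟪a j, x⟫ ∈ Set.Ioc (b j) (b j + δ)}) :=
        (measure_mono hsub).trans (measure_iUnion_fintype_le _ _)
    _ ≤ ∑ j, ENNReal.ofReal δ * (ENNReal.ofReal L * stdGaussian p (firstArgmax a b j)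
          + ENNReal.ofReal (gaussianPDFReal 0 1 L)) :=
        Finset.sum_le_sum fun j _ => stdGaussian_inter_slab_le (ha j)
          (measurableSet_firstArgmax j)
          (fun _ hx _ hs => add_smul_mem_firstArgmax ha j hx hs) hL _ _
    _ = ENNReal.ofReal δ * (ENNReal.ofReal L * stdGaussian p (⋃ j, firstArgmax a b j)
          + p * ENNReal.ofReal (gaussianPDFReal 0 1 L)) := by
        rw [measure_iUnion pairwise_disjoint_firstArgmax measurableSet_firstArgmax, tsum_fintype,
          ← Finset.mul_sum, Finset.sum_add_distrib, ← Finset.mul_sum]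
        simp
    _ ≤ _ := by
        gcongr
        exact mul_le_of_le_one_right' prob_le_one

open ProbabilityTheory in
theorem mul_gaussianPDFReal_sqrt_two_mul_log_le {p : ℕ} (hp : 1 ≤ p) :
    p * gaussianPDFReal 0 1 √(2 * Real.log p) ≤ 1 := by
  have hp' : (1 : ℝ) ≤ p := by exact_mod_cast hp
  have hlog : -√(2 * Real.log p) ^ 2 / 2 = -Real.log p := by
    rw [Real.sq_sqrt (by have := Real.log_nonneg hp'; positivity)]
    ring
  rw [gaussianPDFReal_std_eq, hlog, Real.exp_neg, Real.exp_log (by positivity), mul_left_comm,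
    mul_inv_cancel₀ (by positivity), mul_one]
  refine inv_le_one_of_one_le₀ (Real.one_le_sqrt.2 ?_)
  linarith [Real.pi_gt_three]

/-- **Nazarov's inequality, standard Gaussian form.**
If `X ∼ N(0, I_p)`, `a_1, …, a_p` are unit vectors in `ℝ^p` and `b_1, …, b_p ∈ ℝ`, then for
every `δ > 0`,
`P(⟨a_j, X⟩ ≤ b_j + δ ∀j) − P(⟨a_j, X⟩ ≤ b_j ∀j) ≤ δ(√(2 log p) + 2)`. -/
theorem nazarov_inequality_std_gaussian {Ω : Type*} [MeasurableSpace Ω]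
    (P : Measure Ω) [IsProbabilityMeasure P] {p : ℕ} (hp : 1 ≤ p)
    (X : Ω → EuclideanSpace ℝ (Fin p)) (hXmeas : Measurable X)
    (hX : Measure.map X P = stdGaussian p)
    (a : Fin p → EuclideanSpace ℝ (Fin p)) (ha : ∀ j, ‖a j‖ = 1)
    (b : Fin p → ℝ) (δ : ℝ) (hδ : 0 < δ) :
    (P {ω | ∀ j, ⟪a j, X ω⟫ ≤ b j + δ}).toReal - (P {ω | ∀ j, ⟪a j, X ω⟫ ≤ b j}).toReal
      ≤ δ * (Real.sqrt (2 * Real.log p) + 2) := by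
  set S : ℝ → Set (EuclideanSpace ℝ (Fin p)) := fun s => {x | ∀ j, ⟪a j, x⟫ ≤ b j + s} with hS
  have hSm (s : ℝ) : MeasurableSet (S s) := by
    simp only [hS, Set.ofPred_forall]
    exact MeasurableSet.iInter fun j => measurableSet_le (by fun_prop) measurable_const
  have hP (s : ℝ) : (P {ω | ∀ j, ⟪a j, X ω⟫ ≤ b j + s}).toReal = (stdGaussian p).real (S s) := by
    rw [measureReal_def, ← hX, Measure.map_apply hXmeas (hSm s)]
    rfl
  have hS0 : S 0 = {x | ∀ j, ⟪a j, x⟫ ≤ b j} := by simp [hS]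
  have hP0 : (P {ω | ∀ j, ⟪a j, X ω⟫ ≤ b j}).toReal = (stdGaussian p).real (S 0) := by
    simpa using hP 0
  have hle := stdGaussian_diff_le hp ha b δ (Real.sqrt_nonneg (2 * Real.log p))
  rw [← hS0] at hle
  have hpdf := mul_gaussianPDFReal_sqrt_two_mul_log_le hp
  have hφ := ProbabilityTheory.gaussianPDFReal_nonneg 0 1 √(2 * Real.log p)
  rw [← ENNReal.ofReal_natCast p, ← ENNReal.ofReal_mul (by positivity),
    ← ENNReal.ofReal_add (by positivity) (by positivity), ← ENNReal.ofReal_mul hδ.le] at hle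
  rw [hP, hP0]
  calc (stdGaussian p).real (S δ) - (stdGaussian p).real (S 0)
      ≤ (stdGaussian p).real (S δ \ S 0) := le_measureReal_sdiff
    _ ≤ δ * (√(2 * Real.log p)
          + p * ProbabilityTheory.gaussianPDFReal 0 1 √(2 * Real.log p)) :=
        ENNReal.toReal_le_of_le_ofReal (by positivity) hle
    _ ≤ δ * (√(2 * Real.log p) + 2) := by
        gcongr
        linarith
end

section
/- Let γ_p be the standard Gaussian measure on ℝ^p, let v be a unit vector in ℝ^p, let c ≥ 0, let F ⊂ {x ∈ ℝ^p : ⟨x, v⟩ = c} be a Borel subset of the hyperplane with unit normal v at distance c from the origin, and let N_F = {x + t v : x ∈ F, t > 0}. Then ∫_F φ_p dσ ≤ (c + 1) γ_p(N_F), where σ is the (p−1)-dimensional Hausdorff measure and φ_p the standard Gaussian density. -/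
open MeasureTheory
open scoped RealInnerProductSpace

/-- The standard Gaussian density `φ_p(x) = (2π)^{−p/2} e^{−‖x‖²/2}` on `ℝ^p`. -/
noncomputable def stdGaussianDensity (p : ℕ) (x : EuclideanSpace ℝ (Fin p)) : ℝ :=
  (2 * Real.pi) ^ (-(p : ℝ) / 2) * Real.exp (-‖x‖ ^ 2 / 2)

/-- The standard surface (Lebesgue) measure on the hyperplane `{x : ⟨x, v⟩ = c}` with unit
normal `v`: the pushforward of the canonical Lebesgue measure on the orthogonal complement of
`v` under the affine isometry `w ↦ c • v + w` onto the hyperplane.  (For sets contained in the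
hyperplane it coincides with the (`p−1`)-dimensional Hausdorff measure, suitably normalized.) -/
noncomputable def surfMeasure {p : ℕ} (v : EuclideanSpace ℝ (Fin p)) (c : ℝ) :
    Measure (EuclideanSpace ℝ (Fin p)) :=
  Measure.map (fun w : (Submodule.span ℝ {v})ᗮ => c • v + (w : EuclideanSpace ℝ (Fin p))) volume

open Set Filter Topology in
/-- A lower bound for the one-dimensional Gaussian tail (a form of Mills' inequality). -/
lemma ofReal_exp_neg_sq_le_mul_lintegral_Ioi {c : ℝ} (hc : 0 ≤ c) :
    ENNReal.ofReal (Real.exp (-c ^ 2 / 2)) ≤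
      ENNReal.ofReal (c + 1) * ∫⁻ t in Ioi c, ENNReal.ofReal (Real.exp (-t ^ 2 / 2)) := by
  set G : ℝ → ℝ := fun t => Real.exp (-t ^ 2 / 2) / (t - c + 1) with hG
  set G' : ℝ → ℝ := fun t =>
    (Real.exp (-t ^ 2 / 2) * (-t) * (t - c + 1) - Real.exp (-t ^ 2 / 2) * 1) / (t - c + 1) ^ 2
    with hG'
  have hderiv : ∀ t ∈ Ici c, HasDerivAt G (G' t) t := by
    intro t ht
    have ht' : t - c + 1 ≠ 0 := by linarith [mem_Ici.1 ht]
    refine HasDerivAt.div ?_ (((hasDerivAt_id t).sub_const c).add_const 1) ht'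
    have h : HasDerivAt (fun t : ℝ => -t ^ 2 / 2) (-t) t := by
      convert! ((hasDerivAt_pow 2 t).neg.div_const 2) using 1
      simp only [Nat.cast_ofNat]
      ring
    exact h.exp
  have hneg : ∀ t ∈ Ioi c, G' t ≤ 0 := by
    intro t ht
    have ht' := mem_Ioi.1 ht
    have he := Real.exp_pos (-t ^ 2 / 2)
    refine div_nonpos_of_nonpos_of_nonneg ?_ (sq_nonneg _)
    have : 0 ≤ Real.exp (-t ^ 2 / 2) * (t * (t - c + 1)) :=
      mul_nonneg he.le (mul_nonneg (by linarith) (by linarith))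
    linarith
  have hlim : Tendsto G atTop (𝓝 0) := by
    have h1 : Tendsto (fun t : ℝ => (t - c + 1)⁻¹) atTop (𝓝 0) :=
      tendsto_inv_atTop_zero.comp
        (tendsto_atTop_add_const_right _ _ (tendsto_atTop_add_const_right _ _ tendsto_id))
    refine squeeze_zero' ?_ ?_ h1
    · filter_upwards [eventually_ge_atTop c] with t ht
      exact div_nonneg (Real.exp_pos _).le (by linarith)
    · filter_upwards [eventually_ge_atTop c] with t ht
      rw [hG, ← one_div]
      have : 0 < t - c + 1 := by linarith
      dsimp only
      gcongr
      exact Real.exp_le_one_iff.2 (by nlinarith [sq_nonneg t])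
  have hint := integral_Ioi_of_hasDerivAt_of_nonpos' hderiv hneg hlim
  have hGc : G c = Real.exp (-c ^ 2 / 2) := by simp [hG]
  have hintg := integrableOn_Ioi_deriv_of_nonpos' hderiv hneg hlim
  have hexp : Real.exp (-c ^ 2 / 2) = ∫ t in Ioi c, (-G') t := by
    rw [integral_neg' G', hint, hGc]; ring
  rw [hexp, ofReal_integral_eq_lintegral_ofReal hintg.neg
    ((ae_restrict_iff' measurableSet_Ioi).2 (ae_of_all _ fun t ht => neg_nonneg.2 (hneg t ht))),
    ← lintegral_const_mul' _ _ ENNReal.ofReal_ne_top]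
  refine setLIntegral_mono' measurableSet_Ioi fun t ht => ?_
  rw [← ENNReal.ofReal_mul (by linarith)]
  refine ENNReal.ofReal_le_ofReal ?_
  have hs : 0 < t - c := sub_pos.2 ht
  have hden : 0 < (t - c + 1) ^ 2 := by positivity
  rw [Pi.neg_apply, hG', ← neg_div, div_le_iff₀ hden]
  have key : t * (t - c + 1) + 1 ≤ (c + 1) * (t - c + 1) ^ 2 := by
    nlinarith [mul_nonneg hc hs.le, mul_nonneg hc (sq_nonneg (t - c))]
  nlinarith [mul_le_mul_of_nonneg_left key (Real.exp_pos (-t ^ 2 / 2)).le]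

section UnitVector

variable {E : Type*} [NormedAddCommGroup E] [InnerProductSpace ℝ E]

lemma inner_smul_add_orthogonal {v : E} (hv : ‖v‖ = 1) (t : ℝ) (w : (Submodule.span ℝ {v})ᗮ) :
    ⟪t • v + (w : E), v⟫ = t := by
  have h : ⟪(w : E), v⟫ = 0 :=
    Submodule.mem_orthogonal' _ _ |>.1 w.2 v (Submodule.mem_span_singleton_self v)
  simp [inner_add_left, real_inner_smul_left, h, hv]

lemma norm_sq_smul_add_orthogonal {v : E} (hv : ‖v‖ = 1) (t : ℝ)
    (w : (Submodule.span ℝ {v})ᗮ) : ‖t • v + (w : E)‖ ^ 2 = t ^ 2 + ‖(w : E)‖ ^ 2 := by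
  have h : ⟪v, (w : E)⟫ = 0 :=
    Submodule.mem_orthogonal _ _ |>.1 w.2 v (Submodule.mem_span_singleton_self v)
  simp [norm_add_sq_real, real_inner_smul_left, h, norm_smul, hv]

/-- The decomposition of space into a line and its orthogonal complement preserves volume. -/
lemma measurePreserving_smul_add_orthogonal [FiniteDimensional ℝ E] [MeasurableSpace E]
    [BorelSpace E] {v : E} (hv : ‖v‖ = 1) :
    MeasurePreserving (fun q : ℝ × (Submodule.span ℝ {v})ᗮ => q.1 • v + (q.2 : E))
      (volume.prod volume) volume := by
  have h1 : MeasurePreserving (LinearIsometryEquiv.toSpanUnitSingleton (𝕜 := ℝ) v hv) :=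
    LinearIsometryEquiv.measurePreserving _
  have h2 := h1.prod (MeasurePreserving.id (volume : Measure (Submodule.span ℝ {v})ᗮ))
  have h3 := (WithLp.volume_preserving_toLp (Submodule.span ℝ {v}) (Submodule.span ℝ {v})ᗮ)
  have h4 := (Submodule.orthogonalDecomposition (𝕜 := ℝ)
    (Submodule.span ℝ {v})).symm.measurePreserving
  exact (h4.comp h3).comp h2

lemma setOf_add_smul_eq_of_subset_hyperplane {v : E} (hv : ‖v‖ = 1) {c : ℝ} {F : Set E}
    (hF : F ⊆ {x | ⟪x, v⟫ = c}) :
    {y | ∃ x ∈ F, ∃ t : ℝ, 0 < t ∧ y = x + t • v} =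
      {y | c < ⟪y, v⟫} ∩ (fun y => y + (c - ⟪y, v⟫) • v) ⁻¹' F := by
  ext y
  constructor
  · rintro ⟨x, hx, t, ht, rfl⟩
    have hxc : ⟪x, v⟫ = c := hF hx
    have hi : ⟪x + t • v, v⟫ = c + t := by
      simp [inner_add_left, real_inner_smul_left, hxc, hv]
    refine ⟨by simpa [hi] using ht, ?_⟩
    have : x + t • v + (c - (c + t)) • v = x := by module
    simpa only [Set.mem_preimage, hi, this] using hx
  · rintro ⟨h, hy⟩
    exact ⟨_, hy, ⟪y, v⟫ - c, sub_pos.2 h, by module⟩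

end UnitVector

lemma continuous_stdGaussianDensity (p : ℕ) : Continuous (stdGaussianDensity p) := by
  unfold stdGaussianDensity
  fun_prop

lemma stdGaussianDensity_nonneg (p : ℕ) (x : EuclideanSpace ℝ (Fin p)) :
    0 ≤ stdGaussianDensity p x := by
  unfold stdGaussianDensity
  positivity

lemma integrable_stdGaussianDensity (p : ℕ) : Integrable (stdGaussianDensity p) := by
  have h : Integrable fun x : EuclideanSpace ℝ (Fin p) => Real.exp (-(1 / 2 : ℝ) * ‖x‖ ^ 2) := by
    refine Integrable.of_integral_ne_zero ?_
    rw [GaussianFourier.integral_rexp_neg_mul_sq_norm (by norm_num)]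
    positivity
  refine (h.const_mul ((2 * Real.pi) ^ (-(p : ℝ) / 2))).congr (ae_of_all _ fun x => ?_)
  simp only [stdGaussianDensity]
  ring_nf

lemma stdGaussian_lt_top (p : ℕ) (s : Set (EuclideanSpace ℝ (Fin p))) : stdGaussian p s < ⊤ := by
  have : IsFiniteMeasure (stdGaussian p) :=
    isFiniteMeasure_withDensity_ofReal (integrable_stdGaussianDensity p).2
  exact measure_lt_top _ s

lemma stdGaussianDensity_smul_add_orthogonal {p : ℕ} {v : EuclideanSpace ℝ (Fin p)} (hv : ‖v‖ = 1)
    (t : ℝ) (w : (Submodule.span ℝ {v})ᗮ) :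
    ENNReal.ofReal (stdGaussianDensity p (t • v + (w : EuclideanSpace ℝ (Fin p)))) =
      ENNReal.ofReal (stdGaussianDensity p (w : EuclideanSpace ℝ (Fin p))) *
        ENNReal.ofReal (Real.exp (-t ^ 2 / 2)) := by
  rw [← ENNReal.ofReal_mul (stdGaussianDensity_nonneg p _)]
  simp only [stdGaussianDensity, norm_sq_smul_add_orthogonal hv]
  rw [mul_assoc, ← Real.exp_add]
  ring_nf

/-- The inequality between surface integral and Gaussian measure, for lower integrals. -/
lemma lintegral_surfMeasure_le_mul_stdGaussian {p : ℕ} {v : EuclideanSpace ℝ (Fin p)}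
    (hv : ‖v‖ = 1) {c : ℝ} (hc : 0 ≤ c) {F : Set (EuclideanSpace ℝ (Fin p))}
    (hFmeas : MeasurableSet F) (hFH : F ⊆ {x | ⟪x, v⟫ = c}) :
    ∫⁻ x in F, ENNReal.ofReal (stdGaussianDensity p x) ∂(surfMeasure v c)
      ≤ ENNReal.ofReal (c + 1) *
        stdGaussian p {y | ∃ x ∈ F, ∃ t : ℝ, 0 < t ∧ y = x + t • v} := by
  rw [setOf_add_smul_eq_of_subset_hyperplane hv hFH]
  set N := {y | c < ⟪y, v⟫} ∩ (fun y => y + (c - ⟪y, v⟫) • v) ⁻¹' F with hN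
  have hNmeas : MeasurableSet N := by
    refine MeasurableSet.inter ?_ ?_
    · exact measurableSet_lt measurable_const (by fun_prop)
    · exact (show Measurable fun y : EuclideanSpace ℝ (Fin p) => y + (c - ⟪y, v⟫) • v by
        fun_prop) hFmeas
  have hmem (t : ℝ) (w : (Submodule.span ℝ {v})ᗮ) :
      t • v + (w : EuclideanSpace ℝ (Fin p)) ∈ N ↔
        c < t ∧ c • v + (w : EuclideanSpace ℝ (Fin p)) ∈ F := by
    have : t • v + (w : EuclideanSpace ℝ (Fin p)) + (c - t) • v = c • v + w := by module
    simp only [hN, Set.mem_inter_iff, Set.mem_ofPred_eq, Set.mem_preimage,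
      inner_smul_add_orthogonal hv, this]
  have hdens : Measurable fun x => ENNReal.ofReal (stdGaussianDensity p x) :=
    (continuous_stdGaussianDensity p).measurable.ennreal_ofReal
  have hΦ := measurePreserving_smul_add_orthogonal hv
  have hγ : stdGaussian p N = ∫⁻ x in N, ENNReal.ofReal (stdGaussianDensity p x) :=
    withDensity_apply _ hNmeas
  have hind := hdens.indicator hNmeas
  have hcomp : Measurable fun q : ℝ × (Submodule.span ℝ {v})ᗮ =>
      N.indicator (fun x => ENNReal.ofReal (stdGaussianDensity p x)) (q.1 • v + q.2) :=
    hind.comp hΦ.measurable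
  rw [hγ, ← lintegral_indicator hNmeas, ← hΦ.lintegral_comp hind,
    lintegral_prod_symm' _ hcomp,
    ← lintegral_const_mul' _ _ ENNReal.ofReal_ne_top, ← lintegral_indicator hFmeas, surfMeasure,
    lintegral_map (hdens.indicator hFmeas) (by fun_prop)]
  refine lintegral_mono fun w => ?_
  by_cases hw : c • v + (w : EuclideanSpace ℝ (Fin p)) ∈ F
  · have hline (t : ℝ) : N.indicator (fun x => ENNReal.ofReal (stdGaussianDensity p x))
        (t • v + (w : EuclideanSpace ℝ (Fin p))) =
        (Set.Ioi c).indicator (fun t => ENNReal.ofReal (stdGaussianDensity p w) *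
          ENNReal.ofReal (Real.exp (-t ^ 2 / 2))) t := by
      simp only [Set.indicator, hmem, hw, and_true, Set.mem_Ioi,
        stdGaussianDensity_smul_add_orthogonal hv]
    simp only [hline, Set.indicator_of_mem hw]
    rw [lintegral_indicator measurableSet_Ioi, lintegral_const_mul' _ _ ENNReal.ofReal_ne_top,
      stdGaussianDensity_smul_add_orthogonal hv, mul_left_comm]
    gcongr
    exact ofReal_exp_neg_sq_le_mul_lintegral_Ioi hc
  · simp [Set.indicator_of_notMem hw]

/-- For a Borel subset `F` of the hyperplane `{x : ⟨x, v⟩ = c}` (with `v` a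
unit vector, `c ≥ 0`) and `N_F = {x + t v : x ∈ F, t > 0}`, one has
`∫_F φ_p dσ ≤ (c + 1) γ_p(N_F)`, where `σ` is the surface measure on the hyperplane. -/
theorem surface_integral_le_gaussian_normal_cylinder {p : ℕ} (hp : 1 ≤ p)
    (v : EuclideanSpace ℝ (Fin p)) (hv : ‖v‖ = 1) (c : ℝ) (hc : 0 ≤ c)
    (F : Set (EuclideanSpace ℝ (Fin p))) (hFmeas : MeasurableSet F)
    (hFH : F ⊆ {x | ⟪x, v⟫ = c}) :
    ∫ x in F, stdGaussianDensity p x ∂(surfMeasure v c)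
      ≤ (c + 1) * (stdGaussian p {y | ∃ x ∈ F, ∃ t : ℝ, 0 < t ∧ y = x + t • v}).toReal := by
  rw [integral_eq_lintegral_of_nonneg_ae (ae_of_all _ (stdGaussianDensity_nonneg p))
    (continuous_stdGaussianDensity p).aestronglyMeasurable,
    ← ENNReal.toReal_ofReal (show 0 ≤ c + 1 by linarith), ← ENNReal.toReal_mul]
  exact ENNReal.toReal_mono (ENNReal.mul_ne_top ENNReal.ofReal_ne_top (stdGaussian_lt_top p _).ne)
    (lintegral_surfMeasure_le_mul_stdGaussian hv hc hFmeas hFH)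
end
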